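/- Let A ∈ ℂ^{n×n} be Hermitian positive semidefinite, h ∈ ℂⁿ with h ≠ 0, and σ² > 0, P_B > 0, τ₀ ∈ (0,1] real. Suppose u : (0,∞) → ℂⁿ assigns to each β > 0 a unit vector u(β) satisfying (A + β·h hᴴ)·u(β) = λmax(A + β·h hᴴ)·u(β). Then τ₀·log₂(1 + σ⁻²·P_B·|hᴴ u(β)|²) tends to τ₀·log₂(1 + σ⁻²·P_B·‖h‖²) as β → +∞; in particular, for τ₀ = 1, the achievable downlink rate f_R(P_B·u(β)u(β)ᴴ) converges to R_I^up = log₂(1 + σ⁻² P_B ‖h‖²). -/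

import Mathlib

open Matrix ComplexOrder

/-- The largest eigenvalue of a (Hermitian) complex matrix; junk value `0` if the
matrix is not Hermitian. -/
noncomputable def lmax {n : ℕ} [NeZero n] (A : Matrix (Fin n) (Fin n) ℂ) : ℝ :=
  if hA : A.IsHermitian then ⨆ i, hA.eigenvalues i else 0

theorem star_dotProduct_self_eq_sum {n : ℕ} (x : Fin n → ℂ) :
    star x ⬝ᵥ x = ((∑ i, ‖x i‖ ^ 2 : ℝ) : ℂ) := by
  simp [dotProduct, Complex.conj_mul']

theorem norm_star_dotProduct_sq_le {n : ℕ} (x y : Fin n → ℂ) :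
    ‖star x ⬝ᵥ y‖ ^ 2 ≤ (∑ i, ‖x i‖ ^ 2) * ∑ i, ‖y i‖ ^ 2 := by
  have hxy : ‖star x ⬝ᵥ y‖ ≤ ∑ i, ‖x i‖ * ‖y i‖ := by
    refine (norm_sum_le _ _).trans (le_of_eq ?_)
    simp
  exact (pow_le_pow_left₀ (norm_nonneg _) hxy 2).trans
    (Finset.sum_mul_sq_le_sq_mul_sq _ _ _)

theorem Matrix.IsHermitian.re_dotProduct_mulVec_le_lmax {n : ℕ} [NeZero n]
    {M : Matrix (Fin n) (Fin n) ℂ} (hM : M.IsHermitian) (x : Fin n → ℂ) :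
    (star x ⬝ᵥ (M *ᵥ x)).re ≤ lmax M * ∑ i, ‖x i‖ ^ 2 := by
  have hle : ∀ i, hM.eigenvalues i ≤ lmax M := fun i => by
    rw [lmax, dif_pos hM]
    exact le_ciSup (Set.finite_range _).bddAbove i
  have hdiag : (diagonal fun i => ((lmax M - hM.eigenvalues i : ℝ) : ℂ)).PosSemidef :=
    PosSemidef.diagonal fun i => by
      simpa using Complex.zero_le_real.mpr (sub_nonneg.mpr (hle i))
  have hconj := hdiag.mul_mul_conjTranspose_same
    (hM.eigenvectorUnitary : Matrix (Fin n) (Fin n) ℂ)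
  have hsplit : (diagonal fun i => ((lmax M - hM.eigenvalues i : ℝ) : ℂ))
      = (lmax M : ℂ) • (1 : Matrix (Fin n) (Fin n) ℂ)
        - diagonal (RCLike.ofReal ∘ hM.eigenvalues) := by
    rw [smul_one_eq_diagonal, diagonal_sub]
    simp
  have hspec := hM.spectral_theorem
  rw [Unitary.conjStarAlgAut_apply] at hspec
  have hunit : (hM.eigenvectorUnitary : Matrix (Fin n) (Fin n) ℂ)
      * star (hM.eigenvectorUnitary : Matrix (Fin n) (Fin n) ℂ) = 1 :=
    Unitary.coe_mul_star_self _
  rw [hsplit, mul_sub, sub_mul, mul_smul_comm, mul_one, smul_mul_assoc,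
    ← star_eq_conjTranspose, hunit, ← hspec] at hconj
  have hnonneg := hconj.re_dotProduct_nonneg x
  rw [sub_mulVec, smul_mulVec, one_mulVec, dotProduct_sub, dotProduct_smul,
    star_dotProduct_self_eq_sum, smul_eq_mul, ← Complex.ofReal_mul] at hnonneg
  simpa only [map_sub, RCLike.re_eq_complex_re, Complex.ofReal_re, sub_nonneg] using hnonneg

theorem star_dotProduct_add_smul_vecMulVec_mulVec {n : ℕ} (A : Matrix (Fin n) (Fin n) ℂ)
    (h x : Fin n → ℂ) (β : ℝ) :
    (star x ⬝ᵥ ((A + (β : ℂ) • vecMulVec h (star h)) *ᵥ x)).re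
      = (star x ⬝ᵥ (A *ᵥ x)).re + β * ‖star h ⬝ᵥ x‖ ^ 2 := by
  have hsq : (star x ⬝ᵥ h) * (star h ⬝ᵥ x) = ((‖star h ⬝ᵥ x‖ ^ 2 : ℝ) : ℂ) := by
    have hstar : star x ⬝ᵥ h = star (star h ⬝ᵥ x) := by
      rw [star_dotProduct]
    rw [hstar, Complex.star_def, Complex.conj_mul', Complex.ofReal_pow]
  rw [add_mulVec, smul_mulVec, vecMulVec_mulVec, dotProduct_add, dotProduct_smul,
    op_smul_eq_smul, dotProduct_smul, smul_eq_mul, smul_eq_mul,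
    mul_comm (star h ⬝ᵥ x), hsq, ← Complex.ofReal_mul, Complex.add_re, Complex.ofReal_re]

theorem sum_norm_sq_sub_le_norm_dotProduct_sq {n : ℕ} [NeZero n]
    {A : Matrix (Fin n) (Fin n) ℂ} (hA : A.PosSemidef) {h x : Fin n → ℂ} (hh : h ≠ 0)
    {β : ℝ} (hβ : 0 < β) (hx : ∑ i, ‖x i‖ ^ 2 = 1)
    (heig : (A + (β : ℂ) • vecMulVec h (star h)) *ᵥ x
      = (lmax (A + (β : ℂ) • vecMulVec h (star h)) : ℂ) • x) :
    ∑ i, ‖h i‖ ^ 2 - lmax A / β ≤ ‖star h ⬝ᵥ x‖ ^ 2 := by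
  have hM : (A + (β : ℂ) • vecMulVec h (star h)).IsHermitian :=
    (hA.add ((posSemidef_vecMulVec_self_star h).smul
      (Complex.zero_le_real.mpr hβ.le))).isHermitian
  have hpos : 0 < ∑ i, ‖h i‖ ^ 2 := by
    obtain ⟨i, hi⟩ := Function.ne_iff.mp hh
    exact Finset.sum_pos' (fun _ _ => by positivity)
      ⟨i, Finset.mem_univ i, pow_pos (norm_pos_iff.mpr hi) 2⟩
  have hlower := hM.re_dotProduct_mulVec_le_lmax h
  have hupper := star_dotProduct_add_smul_vecMulVec_mulVec A h x β
  have hAx := hA.isHermitian.re_dotProduct_mulVec_le_lmax x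
  have hAh : 0 ≤ (star h ⬝ᵥ (A *ᵥ h)).re := hA.re_dotProduct_nonneg h
  rw [heig, dotProduct_smul, star_dotProduct_self_eq_sum, hx, smul_eq_mul, Complex.ofReal_one,
    mul_one, Complex.ofReal_re] at hupper
  rw [star_dotProduct_add_smul_vecMulVec_mulVec, star_dotProduct_self_eq_sum,
    Complex.norm_of_nonneg hpos.le] at hlower
  rw [hx, mul_one] at hAx
  have hlmax : β * ∑ i, ‖h i‖ ^ 2 ≤ lmax (A + (β : ℂ) • vecMulVec h (star h)) := by
    refine le_of_mul_le_mul_right ?_ hpos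
    linarith
  rw [sub_le_iff_le_add, ← sub_le_iff_le_add', le_div_iff₀ hβ]
  linarith

/-- **convergence part of Lemma 2.** If `u(β)` is a unit dominant
eigenvector of `A + β h hᴴ` for each `β > 0`, then the downlink rate
`τ₀ log₂(1 + σ⁻² P_B |hᴴ u(β)|²)` tends to `τ₀ log₂(1 + σ⁻² P_B ‖h‖²)` as
`β → +∞`. -/
theorem downlink_rate_tendsto_upper_bound
    (n : ℕ) [NeZero n] (A : Matrix (Fin n) (Fin n) ℂ) (hA : A.PosSemidef)
    (h : Fin n → ℂ) (hh : h ≠ 0)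
    (σ2 PB τ0 : ℝ) (hσ2 : 0 < σ2) (hPB : 0 < PB) (hτ0 : τ0 ∈ Set.Ioc (0 : ℝ) 1)
    (u : ℝ → Fin n → ℂ)
    (hu_norm : ∀ β : ℝ, 0 < β → ∑ i, ‖u β i‖ ^ 2 = 1)
    (hu_eig : ∀ β : ℝ, 0 < β →
      (A + (β : ℂ) • vecMulVec h (star h)) *ᵥ u β
        = (lmax (A + (β : ℂ) • vecMulVec h (star h)) : ℂ) • u β) :
    Filter.Tendsto
      (fun β : ℝ => τ0 * Real.logb 2 (1 + σ2⁻¹ * PB * ‖(star h) ⬝ᵥ u β‖ ^ 2))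
      Filter.atTop
      (nhds (τ0 * Real.logb 2 (1 + σ2⁻¹ * PB * ∑ i, ‖h i‖ ^ 2))) := by
  have hlim : Filter.Tendsto (fun β : ℝ => ∑ i, ‖h i‖ ^ 2 - lmax A / β) Filter.atTop
      (nhds (∑ i, ‖h i‖ ^ 2)) := by
    simpa using tendsto_const_nhds.sub (Filter.Tendsto.const_div_atTop Filter.tendsto_id (lmax A))
  have hgain : Filter.Tendsto (fun β : ℝ => ‖star h ⬝ᵥ u β‖ ^ 2) Filter.atTop
      (nhds (∑ i, ‖h i‖ ^ 2)) := by
    refine tendsto_of_tendsto_of_tendsto_of_le_of_le' hlim tendsto_const_nhds ?_ ?_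
    · filter_upwards [Filter.eventually_gt_atTop 0] with β hβ
      exact sum_norm_sq_sub_le_norm_dotProduct_sq hA hh hβ (hu_norm β hβ) (hu_eig β hβ)
    · filter_upwards [Filter.eventually_gt_atTop 0] with β hβ
      simpa [hu_norm β hβ] using norm_star_dotProduct_sq_le h (u β)
  have hne : 1 + σ2⁻¹ * PB * ∑ i, ‖h i‖ ^ 2 ≠ 0 := by positivity
  exact (((hgain.const_mul _).const_add 1).logb hne).const_mul τ0
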